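/- Let P and Q be weak plane posets. Then the double poset PQ, defined on the disjoint union P ⊔ Q by: x ≤₁ y iff (x, y ∈ P and x ≤₁ y in P) or (x, y ∈ Q and x ≤₁ y in Q); and x ≤₂ y iff (x, y ∈ P and x ≤₂ y in P) or (x, y ∈ Q and x ≤₂ y in Q) or (x ∈ P and y ∈ Q), is again a weak plane poset. -/

import Mathlib

/-- A total quasi-order: reflexive, transitive, and any two elements are comparable. -/
def IsTotalQuasiorder {α : Type*} (r : α → α → Prop) : Prop :=
  (∀ x, r x x) ∧ (∀ x y z, r x y → r y z → r x z) ∧ (∀ x y, r x y ∨ r y x)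

/-- A weak plane poset: a double poset (two partial orders) such that
(1) `x ≤₁ y` and `x ≤₂ y` imply `x = y`, and
(2) the relation `⪯` given by (`x ≤₁ y` or `x ≤₂ y`) is a total quasi-order. -/
def WeakPlanePoset {α : Type*} (le1 le2 : α → α → Prop) : Prop :=
  IsPartialOrder α le1 ∧ IsPartialOrder α le2 ∧
    (∀ x y, le1 x y → le2 x y → x = y) ∧
    IsTotalQuasiorder (fun x y => le1 x y ∨ le2 x y)

/-- The first order of the product double poset `PQ` on the disjoint union `P ⊔ Q`. -/
def sumLe1 {α β : Type*} (leP : α → α → Prop) (leQ : β → β → Prop) :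
    α ⊕ β → α ⊕ β → Prop
  | Sum.inl a, Sum.inl a' => leP a a'
  | Sum.inr b, Sum.inr b' => leQ b b'
  | _, _ => False

/-- The second order of the product double poset `PQ` on the disjoint union `P ⊔ Q`:
everything in `P` is `≤₂` everything in `Q`. -/
def sumLe2 {α β : Type*} (leP : α → α → Prop) (leQ : β → β → Prop) :
    α ⊕ β → α ⊕ β → Prop
  | Sum.inl a, Sum.inl a' => leP a a'
  | Sum.inr b, Sum.inr b' => leQ b b'
  | Sum.inl _, Sum.inr _ => True
  | Sum.inr _, Sum.inl _ => False

theorem isPartialOrder_sumLe1 {α β : Type*} {leP : α → α → Prop} {leQ : β → β → Prop}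
    (hP : IsPartialOrder α leP) (hQ : IsPartialOrder β leQ) :
    IsPartialOrder (α ⊕ β) (sumLe1 leP leQ) where
  refl := by
    rintro (a | b)
    · exact hP.refl a
    · exact hQ.refl b
  trans := by
    rintro (a | b) (a' | b') (a'' | b'') h h' <;> simp only [sumLe1] at h h' ⊢
    · exact hP.trans _ _ _ h h'
    · exact hQ.trans _ _ _ h h'
  antisymm := by
    rintro (a | b) (a' | b') h h' <;> simp only [sumLe1] at h h'
    · exact congrArg Sum.inl (hP.antisymm _ _ h h')
    · exact congrArg Sum.inr (hQ.antisymm _ _ h h')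

theorem isPartialOrder_sumLe2 {α β : Type*} {leP : α → α → Prop} {leQ : β → β → Prop}
    (hP : IsPartialOrder α leP) (hQ : IsPartialOrder β leQ) :
    IsPartialOrder (α ⊕ β) (sumLe2 leP leQ) where
  refl := by
    rintro (a | b)
    · exact hP.refl a
    · exact hQ.refl b
  trans := by
    rintro (a | b) (a' | b') (a'' | b'') h h' <;> simp only [sumLe2] at h h' ⊢
    · exact hP.trans _ _ _ h h'
    · exact hQ.trans _ _ _ h h'
  antisymm := by
    rintro (a | b) (a' | b') h h' <;> simp only [sumLe2] at h h'
    · exact congrArg Sum.inl (hP.antisymm _ _ h h')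
    · exact congrArg Sum.inr (hQ.antisymm _ _ h h')

/-- the product `PQ` of two weak plane posets `P`, `Q` is again a
weak plane poset. -/
theorem product_of_weak_plane_posets {α β : Type*} [Fintype α] [Fintype β]
    (leP1 leP2 : α → α → Prop) (leQ1 leQ2 : β → β → Prop)
    (hP : WeakPlanePoset leP1 leP2) (hQ : WeakPlanePoset leQ1 leQ2) :
    WeakPlanePoset (sumLe1 leP1 leQ1) (sumLe2 leP2 leQ2) := by
  obtain ⟨hP1, hP2, hP, reflP, transP, totalP⟩ := hP
  obtain ⟨hQ1, hQ2, hQ, reflQ, transQ, totalQ⟩ := hQ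
  refine ⟨isPartialOrder_sumLe1 hP1 hQ1, isPartialOrder_sumLe2 hP2 hQ2, ?_, ?_, ?_, ?_⟩
  · rintro (a | b) (a' | b') h h' <;> simp only [sumLe1] at h
    · exact congrArg Sum.inl (hP _ _ h h')
    · exact congrArg Sum.inr (hQ _ _ h h')
  · rintro (a | b)
    · exact reflP a
    · exact reflQ b
  · rintro (a | b) (a' | b') (a'' | b'') h h' <;>
      simp only [sumLe1, sumLe2, or_false, or_true] at h h' ⊢
    · exact transP _ _ _ h h'
    · exact transQ _ _ _ h h'
  · rintro (a | b) (a' | b')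
    · exact totalP a a'
    · exact Or.inl (Or.inr trivial)
    · exact Or.inr (Or.inr trivial)
    · exact totalQ b b'
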